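/- Let N ≥ 1 and let A be Haar-distributed on U(N). Then E[ Σ_{k≥1} |Tr(A^k)|²/k² ] = Σ_{k≥1} min{k, N}/k². Equivalently, E[N² W₂²(μ_A, λ_T)] = 2 Σ_{k≥1} min{k, N}/k². -/

import Mathlib

open MeasureTheory ProbabilityTheory Matrix

noncomputable section

instance matrixMeasurableSpace {m n α : Type*} [MeasurableSpace α] :
    MeasurableSpace (Matrix m n α) :=
  show MeasurableSpace (m → n → α) from inferInstance

section LogDerivative

variable {R : Type*} [CommRing R]

/-- The power series `∑_{m ≥ 1} p m * X ^ m`. -/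
def positivePart (p : ℕ → R) : PowerSeries R :=
  PowerSeries.mk fun m => if m = 0 then 0 else p m

theorem coeff_positivePart_mul (p : ℕ → R) (F : PowerSeries R) (n : ℕ) :
    PowerSeries.coeff n (positivePart p * F)
      = ∑ m ∈ Finset.range n, p (n - m) * PowerSeries.coeff m F := by
  rw [mul_comm, PowerSeries.coeff_mul, Finset.Nat.sum_antidiagonal_eq_sum_range_succ_mk,
    Finset.sum_range_succ]
  simp only [positivePart, PowerSeries.coeff_mk, Nat.sub_self, if_true, mul_zero, add_zero]
  refine Finset.sum_congr rfl fun m hm => ?_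
  rw [if_neg (by have := Finset.mem_range.1 hm; omega), mul_comm]

theorem coeff_X_mul_derivative (F : PowerSeries R) (n : ℕ) :
    PowerSeries.coeff n (PowerSeries.X * PowerSeries.derivative R F)
      = n * PowerSeries.coeff n F := by
  cases n with
  | zero => simp
  | succ n =>
    rw [PowerSeries.coeff_succ_X_mul, PowerSeries.coeff_derivative]
    push_cast; ring

theorem positivePart_neg (p : ℕ → R) : positivePart (-p) = -positivePart p := by
  ext n; by_cases h : n = 0 <;> simp [positivePart, h]

variable [Algebra ℚ R]

theorem natCast_mul_cancel {n : ℕ} {x y : R} (hn : n ≠ 0) (h : (n : R) * x = n * y) : x = y := by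
  have hq : algebraMap ℚ R (n : ℚ)⁻¹ * (n : R) = 1 := by
    rw [← map_natCast (algebraMap ℚ R), ← map_mul, inv_mul_cancel₀ (by exact_mod_cast hn), map_one]
  calc x = algebraMap ℚ R (n : ℚ)⁻¹ * (n * x) := by rw [← mul_assoc, hq, one_mul]
    _ = y := by rw [h, ← mul_assoc, hq, one_mul]

/-- A solution of `X F' = P F`, with `P` of positive order, is determined by its constant term. -/
theorem powerSeries_ext_of_logDerivative (p : ℕ → R) {F G : PowerSeries R}
    (hF : PowerSeries.X * PowerSeries.derivative R F = positivePart p * F)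
    (hG : PowerSeries.X * PowerSeries.derivative R G = positivePart p * G)
    (h0 : PowerSeries.coeff 0 F = PowerSeries.coeff 0 G) : F = G := by
  ext n
  induction n using Nat.strong_induction_on with
  | _ n ih =>
    rcases Nat.eq_zero_or_pos n with rfl | hn
    · exact h0
    · refine natCast_mul_cancel hn.ne' ?_
      rw [← coeff_X_mul_derivative, ← coeff_X_mul_derivative, hF, hG, coeff_positivePart_mul,
        coeff_positivePart_mul]
      exact Finset.sum_congr rfl fun m hm => by rw [ih m (Finset.mem_range.1 hm)]

/-- The complete homogeneous symmetric functions attached to the power sums `p`, defined by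
Newton's recursion `n h_n = ∑_{m < n} p_{n-m} h_m`. -/
def completeHom (p : ℕ → R) : ℕ → R
  | 0 => 1
  | n + 1 => algebraMap ℚ R ((n + 1 : ℕ) : ℚ)⁻¹ * ∑ m : Fin (n + 1), p (n + 1 - m) * completeHom p m

theorem natCast_mul_completeHom (p : ℕ → R) (n : ℕ) :
    (n : R) * completeHom p n = ∑ m ∈ Finset.range n, p (n - m) * completeHom p m := by
  cases n with
  | zero => simp
  | succ n =>
    rw [completeHom, Finset.sum_range, ← mul_assoc, ← map_natCast (algebraMap ℚ R), ← map_mul,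
      mul_inv_cancel₀ (by positivity), map_one, one_mul]

theorem logDerivative_completeHom (p : ℕ → R) :
    PowerSeries.X * PowerSeries.derivative R (PowerSeries.mk (completeHom p))
      = positivePart p * PowerSeries.mk (completeHom p) := by
  ext n
  rw [coeff_X_mul_derivative, coeff_positivePart_mul]
  simpa using natCast_mul_completeHom p n

theorem completeHom_mul_completeHom_neg (p : ℕ → R) :
    PowerSeries.mk (completeHom p) * PowerSeries.mk (completeHom (-p)) = 1 := by
  refine powerSeries_ext_of_logDerivative 0 ?_ ?_ ?_
  · have h1 := logDerivative_completeHom p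
    have h2 := logDerivative_completeHom (-p)
    rw [positivePart_neg] at h2
    have : positivePart (0 : ℕ → R) = 0 := by ext n; simp [positivePart]
    rw [Derivation.leibniz, this, smul_eq_mul, smul_eq_mul]
    linear_combination PowerSeries.mk (completeHom p) * h2
      + PowerSeries.mk (completeHom (-p)) * h1
  · have : positivePart (0 : ℕ → R) = 0 := by ext n; simp [positivePart]
    simp [this]
  · simp [PowerSeries.coeff_mul, completeHom]

theorem sum_completeHom_neg_mul (p : ℕ → R) {k : ℕ} (hk : k ≠ 0) :
    ∑ j ∈ Finset.range (k + 1), completeHom p (k - j) * completeHom (-p) j = 0 := by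
  have h := congrArg (PowerSeries.coeff k) (completeHom_mul_completeHom_neg p)
  rw [mul_comm, PowerSeries.coeff_mul, Finset.Nat.sum_antidiagonal_eq_sum_range_succ_mk] at h
  simpa [PowerSeries.coeff_one, hk, mul_comm] using h

theorem sum_natCast_mul_completeHom_neg (p : ℕ → R) {k : ℕ} (hk : k ≠ 0) :
    ∑ j ∈ Finset.range (k + 1), (j : R) * (completeHom p (k - j) * completeHom (-p) j) = -p k := by
  have h2 := logDerivative_completeHom (-p)
  rw [positivePart_neg] at h2
  have h3 : (PowerSeries.X * PowerSeries.derivative R (PowerSeries.mk (completeHom (-p))))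
      * PowerSeries.mk (completeHom p) = -positivePart p := by
    rw [h2]; linear_combination -positivePart p * completeHom_mul_completeHom_neg p
  have h := congrArg (PowerSeries.coeff k) h3
  rw [PowerSeries.coeff_mul, Finset.Nat.sum_antidiagonal_eq_sum_range_succ_mk] at h
  simp only [coeff_X_mul_derivative] at h
  simpa [positivePart, hk, mul_comm, mul_left_comm] using h

end LogDerivative

section MatrixConvolution

variable {R : Type*} [CommRing R] {n : Type*} [Fintype n] [DecidableEq n]

/-- The matrix `∑_{m < a} f m • A ^ (a - m)`. -/
def powerConvolution (A : Matrix n n R) (f : ℕ → R) (a : ℕ) : Matrix n n R :=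
  ∑ m ∈ Finset.range a, f m • A ^ (a - m)

theorem powerConvolution_succ (A : Matrix n n R) (f : ℕ → R) (a : ℕ) :
    powerConvolution A f (a + 1) = A * (powerConvolution A f a + f a • 1) := by
  rw [powerConvolution, Finset.sum_range_succ, powerConvolution, mul_add, Finset.mul_sum]
  congr 1
  · refine Finset.sum_congr rfl fun m hm => ?_
    rw [mul_smul_comm, ← pow_succ', Nat.sub_add_comm (Finset.mem_range.1 hm).le]
  · simp

theorem powerConvolution_succ' (A : Matrix n n R) (f : ℕ → R) (a : ℕ) :
    powerConvolution A f (a + 1) = (powerConvolution A f a + f a • 1) * A := by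
  rw [powerConvolution, Finset.sum_range_succ, powerConvolution, add_mul, Finset.sum_mul]
  congr 1
  · refine Finset.sum_congr rfl fun m hm => ?_
    rw [smul_mul_assoc, ← pow_succ, Nat.sub_add_comm (Finset.mem_range.1 hm).le]
  · simp

theorem powerConvolution_apply (A : Matrix n n R) (f : ℕ → R) (a : ℕ) (i j : n) :
    powerConvolution A f a i j = PowerSeries.coeff a
      (positivePart (fun m => (A ^ m) i j) * PowerSeries.mk f) := by
  rw [coeff_positivePart_mul, powerConvolution, Matrix.sum_apply]
  simp [mul_comm]

theorem derivation_det {k : Type*} [CommRing k] [Algebra k R] (D : Derivation k R R)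
    (M : Matrix n n R) : D M.det = (M.adjugate * M.map D).trace := by
  have hprod : ∀ (s : Finset n) (f : n → R),
      D (∏ i ∈ s, f i) = ∑ i ∈ s, D (f i) * ∏ j ∈ s.erase i, f j := by
    intro s f
    induction s using Finset.induction_on with
    | empty => simp
    | insert a s ha ih =>
      rw [Finset.prod_insert ha, Derivation.leibniz, ih, Finset.sum_insert ha,
        Finset.erase_insert ha, smul_eq_mul, smul_eq_mul, Finset.mul_sum, add_comm,
        mul_comm (∏ i ∈ s, f i)]
      congr 1
      refine Finset.sum_congr rfl fun i hi => ?_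
      have hia : a ≠ i := by rintro rfl; exact ha hi
      rw [Finset.erase_insert_of_ne hia, Finset.prod_insert (by simp [ha])]
      ring
  have hdet : D M.det = ∑ j, (M.updateCol j fun i => D (M i j)).det := by
    simp only [Matrix.det_apply, map_sum, Units.smul_def, map_zsmul, hprod]
    rw [Finset.sum_comm]
    refine Finset.sum_congr rfl fun σ _ => ?_
    rw [← Finset.smul_sum]
    congr 1
    refine Finset.sum_congr rfl fun j _ => ?_
    rw [← Finset.mul_prod_erase _ _ (Finset.mem_univ j), Matrix.updateCol_self]
    congr 1
    refine Finset.prod_congr rfl fun i hi => ?_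
    rw [Matrix.updateCol_ne (Finset.ne_of_mem_erase hi)]
  rw [hdet, Matrix.trace]
  refine Finset.sum_congr rfl fun j _ => ?_
  rw [← Matrix.cramer_apply, Matrix.cramer_eq_adjugate_mulVec]
  rfl

variable [Algebra ℚ R]

theorem trace_powerConvolution_completeHom (A : Matrix n n R) (a : ℕ) :
    (powerConvolution A (completeHom fun m => (A ^ m).trace) a).trace
      = a * completeHom (fun m => (A ^ m).trace) a := by
  simp [natCast_mul_completeHom, powerConvolution, Matrix.trace_sum, Matrix.trace_smul, mul_comm]

theorem trace_powerConvolution_completeHom_neg (A : Matrix n n R) (b : ℕ) :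
    (powerConvolution A (completeHom (-fun m => (A ^ m).trace)) b).trace
      = -(b * completeHom (-fun m => (A ^ m).trace) b) := by
  simp [natCast_mul_completeHom, powerConvolution, Matrix.trace_sum, Matrix.trace_smul, mul_comm]

theorem trace_powerConvolution_mul_powerConvolution (A : Matrix n n R) (a b : ℕ) :
    (powerConvolution A (completeHom fun m => (A ^ m).trace) a
        * powerConvolution A (completeHom (-fun m => (A ^ m).trace)) b).trace
      = (a + b : ℕ) * (∑ j ∈ Finset.range b, completeHom (fun m => (A ^ m).trace) (a + b - j)
          * completeHom (-fun m => (A ^ m).trace) j)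
        + b * (completeHom (fun m => (A ^ m).trace) a
          * completeHom (-fun m => (A ^ m).trace) b) := by
  set h := completeHom fun m => (A ^ m).trace with hh
  set e := completeHom (-fun m => (A ^ m).trace) with he
  induction b generalizing a with
  | zero => simp [powerConvolution]
  | succ b ih =>
    have h1 := trace_powerConvolution_completeHom A (a + 1)
    have h2 := trace_powerConvolution_completeHom_neg A (b + 1)
    have h3 := ih (a + 1)
    rw [← hh] at h1
    rw [← he] at h2
    rw [powerConvolution_succ'] at h1
    rw [powerConvolution_succ] at h2 ⊢
    rw [powerConvolution_succ', add_mul, add_mul, smul_mul_assoc, one_mul] at h3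
    rw [add_mul, smul_mul_assoc, one_mul, Matrix.trace_add, Matrix.trace_smul] at h1
    rw [mul_add, mul_smul_comm, mul_one, Matrix.trace_add, Matrix.trace_smul] at h2
    rw [Matrix.trace_add, smul_mul_assoc, Matrix.trace_smul] at h3
    rw [mul_add, mul_add, mul_smul_comm, mul_one, mul_smul_comm, Matrix.trace_add,
      Matrix.trace_smul, ← mul_assoc, Finset.sum_range_succ]
    rw [show a + 1 + b = a + (b + 1) by ring] at h3
    rw [show a + (b + 1) - b = a + 1 by omega]
    simp only [smul_eq_mul] at *
    push_cast at *
    linear_combination h3 + e b * h1 - h a * h2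

/-- The signed elementary symmetric functions of an `n × n` matrix vanish above degree `n`. -/
theorem completeHom_neg_trace_eq_zero (A : Matrix n n R) {b : ℕ} (hb : Fintype.card n < b) :
    completeHom (-fun m => (A ^ m).trace) b = 0 := by
  set F : Polynomial R := A.charpolyRev with hF
  set M : Matrix n n (Polynomial R) := 1 - (Polynomial.X : Polynomial R) • A.map Polynomial.C with hM
  have hFM : F = M.det := rfl
  have hder : Polynomial.X * Polynomial.derivative F
      = (Fintype.card n : Polynomial R) * F - M.adjugate.trace := by
    have h1 : (Polynomial.X : Polynomial R) • M.map (Polynomial.derivative' (R := R)) = M - 1 := by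
      ext1 i j
      by_cases hij : i = j <;>
        simp [hM, hij]
    have h2 := derivation_det (Polynomial.derivative' (R := R)) M
    have h3 : Polynomial.derivative F = Polynomial.derivative' (R := R) M.det := rfl
    rw [h3, h2, ← smul_eq_mul, ← Matrix.trace_smul, ← mul_smul_comm, h1, mul_sub,
      Matrix.adjugate_mul, Matrix.trace_sub, mul_one, Matrix.trace_smul, Matrix.trace_one,
      smul_eq_mul, ← hFM, mul_comm]
  have hadj : (M.adjugate.trace : PowerSeries R)
      = (F : PowerSeries R) * (Fintype.card n + positivePart fun m => (A ^ m).trace) := by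
    set φ := Polynomial.coeToPowerSeries.ringHom (R := R)
    set S : Matrix n n (PowerSeries R) := Matrix.of fun i j => PowerSeries.mk fun m => (A ^ m) i j
      with hS
    have hMS : φ.mapMatrix M * S = 1 := by
      have h1 : φ.mapMatrix M = 1 - (PowerSeries.X : PowerSeries R) • A.map PowerSeries.C := by
        ext1 i j
        by_cases hij : i = j <;> simp [φ, hM, hij] <;> ring
      rw [h1, sub_mul, one_mul, smul_mul_assoc]
      ext i j m
      cases m with
      | zero => by_cases hij : i = j <;> simp [hS, Matrix.one_apply, hij]
      | succ m =>
        have : PowerSeries.coeff (m + 1) ((1 : Matrix n n (PowerSeries R)) i j) = 0 := by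
          by_cases hij : i = j <;> simp [Matrix.one_apply, hij, PowerSeries.coeff_one]
        rw [this]
        simp [hS, PowerSeries.coeff_succ_X_mul, Matrix.mul_apply, pow_succ']
    have htr : S.trace = Fintype.card n + positivePart fun m => (A ^ m).trace := by
      ext m
      rw [map_add, ← map_natCast (PowerSeries.C (R := R)), PowerSeries.coeff_C]
      rcases eq_or_ne m 0 with rfl | hm <;> simp [Matrix.trace, positivePart, *]
    have hFφ : (φ.mapMatrix M).det = F := by
      rw [← RingHom.map_det, ← hFM]; rfl
    have hadj' : (φ.mapMatrix M).adjugate = (F : PowerSeries R) • S := by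
      rw [← mul_one (φ.mapMatrix M).adjugate, ← hMS, ← mul_assoc, Matrix.adjugate_mul, hFφ,
        smul_mul_assoc, one_mul]
    rw [← htr, ← smul_eq_mul, ← Matrix.trace_smul, ← hadj', ← RingHom.map_adjugate]
    exact AddMonoidHom.map_trace φ.toAddMonoidHom M.adjugate
  have hFE : (F : PowerSeries R) = PowerSeries.mk (completeHom (-fun m => (A ^ m).trace)) := by
    refine powerSeries_ext_of_logDerivative (-fun m => (A ^ m).trace) ?_
      (logDerivative_completeHom _) ?_
    · have := congrArg (fun G : Polynomial R => (G : PowerSeries R)) hder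
      simp only [Polynomial.coe_mul, Polynomial.coe_sub, Polynomial.coe_X] at this
      rw [PowerSeries.derivative_coe, this, hadj, positivePart_neg]
      have : ((Fintype.card n : Polynomial R) : PowerSeries R) = Fintype.card n :=
        map_natCast (Polynomial.coeToPowerSeries.ringHom (R := R)) _
      rw [this]
      ring
    · simp [completeHom, hF, Polynomial.coeff_zero_eq_eval_zero]
  have hdeg : F.natDegree ≤ Fintype.card n := by
    have := Polynomial.natDegree_det_X_add_C_le (-A) 1
    rwa [show (Polynomial.X : Polynomial R) • (-A).map Polynomial.C + (1 : Matrix n n R).map Polynomial.C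
      = M by ext1 i j; by_cases hij : i = j <;> simp [hM, hij, sub_eq_neg_add]] at this
  have := congrArg (PowerSeries.coeff b) hFE
  rw [Polynomial.coeff_coe, Polynomial.coeff_eq_zero_of_natDegree_lt (by omega)] at this
  simpa using this.symm

end MatrixConvolution

section Laplacian

variable {k R : Type*} [CommRing k] [CommRing R] [Algebra k R]

/-- The coefficientwise extension of a derivation to power series. -/
def coeffwise (D : Derivation k R R) (F : PowerSeries R) : PowerSeries R :=
  PowerSeries.mk fun m => D (PowerSeries.coeff m F)

theorem coeffwise_mul (D : Derivation k R R) (F G : PowerSeries R) :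
    coeffwise D (F * G) = coeffwise D F * G + F * coeffwise D G := by
  ext m
  simp only [coeffwise, PowerSeries.coeff_mk, PowerSeries.coeff_mul, map_sum, map_add,
    ← Finset.sum_add_distrib, Derivation.leibniz, smul_eq_mul]
  exact Finset.sum_congr rfl fun _ _ => by ring

theorem derivation_completeHom [Algebra ℚ R] (D : Derivation k R R) (p d : ℕ → R)
    (hd : ∀ m, D (p m) = m * d m) (a : ℕ) :
    D (completeHom p a) = ∑ m ∈ Finset.range a, d (a - m) * completeHom p m := by
  have hXD : ∀ F : PowerSeries R,
      coeffwise D (PowerSeries.X * PowerSeries.derivative R F)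
        = PowerSeries.X * PowerSeries.derivative R (coeffwise D F) := by
    intro F
    ext m
    rw [coeff_X_mul_derivative, coeffwise, PowerSeries.coeff_mk, coeff_X_mul_derivative]
    simp [coeffwise]
  have hP : coeffwise D (positivePart p)
      = PowerSeries.X * PowerSeries.derivative R (positivePart d) := by
    ext m
    rw [coeff_X_mul_derivative]
    by_cases h : m = 0 <;> simp [coeffwise, positivePart, h, hd]
  set H := PowerSeries.mk (completeHom p) with hH
  have hXH : PowerSeries.X * PowerSeries.derivative R H = positivePart p * H :=
    logDerivative_completeHom p
  have hDXH := congrArg (coeffwise D) hXH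
  rw [hXD, coeffwise_mul, hP] at hDXH
  have key : coeffwise D H - positivePart d * H = 0 := by
    refine powerSeries_ext_of_logDerivative p ?_ (by simp) ?_
    · rw [map_sub, Derivation.leibniz, smul_eq_mul, smul_eq_mul]
      linear_combination hDXH - positivePart d * hXH
    · simp [coeffwise, hH, completeHom, positivePart]
  have := congrArg (PowerSeries.coeff a) (sub_eq_zero.1 key)
  rw [coeff_positivePart_mul] at this
  simpa [coeffwise, hH] using this

variable {n : Type*} [Fintype n] [DecidableEq n]

theorem derivation_matrix_pow {A : Matrix n n R} {D : n → n → Derivation k R R}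
    (hD : ∀ i j a b, D i j (A a b) = if a = i then A j b else 0) (i j : n) (m : ℕ) (a b : n) :
    D i j ((A ^ m) a b) = ∑ l ∈ Finset.range m, (A ^ l) a i * (A ^ (m - l)) j b := by
  induction m generalizing b with
  | zero => by_cases h : a = b <;> simp [Matrix.one_apply, h]
  | succ m ih =>
    have h1 : D i j ((A ^ (m + 1)) a b)
        = ∑ c, (D i j ((A ^ m) a c) * A c b + (A ^ m) a c * D i j (A c b)) := by
      rw [pow_succ, Matrix.mul_apply, map_sum]
      exact Finset.sum_congr rfl fun c _ => by
        rw [Derivation.leibniz, smul_eq_mul, smul_eq_mul]; ring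
    rw [h1, Finset.sum_add_distrib, Finset.sum_range_succ]
    congr 1
    · simp_rw [ih, Finset.sum_mul]
      rw [Finset.sum_comm]
      refine Finset.sum_congr rfl fun l hl => ?_
      rw [Nat.sub_add_comm (Finset.mem_range.1 hl).le, pow_succ, Matrix.mul_apply, Finset.mul_sum]
      simp_rw [mul_assoc]
    · simp [hD]

theorem derivation_trace_pow {A : Matrix n n R} {D : n → n → Derivation k R R}
    (hD : ∀ i j a b, D i j (A a b) = if a = i then A j b else 0) (i j : n) (m : ℕ) :
    D i j (A ^ m).trace = m * (A ^ m) j i := by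
  simp only [Matrix.trace, Matrix.diag_apply, map_sum, derivation_matrix_pow hD]
  rw [Finset.sum_comm]
  have : ∀ l ∈ Finset.range m, ∑ a, (A ^ l) a i * (A ^ (m - l)) j a = (A ^ m) j i := by
    intro l hl
    simp_rw [mul_comm ((A ^ l) _ i)]
    rw [← Matrix.mul_apply, ← pow_add, Nat.sub_add_cancel (Finset.mem_range.1 hl).le]
  rw [Finset.sum_congr rfl this]
  simp

variable [Algebra ℚ R]

theorem derivation_completeHom_trace {A : Matrix n n R} {D : n → n → Derivation k R R}
    (hD : ∀ i j a b, D i j (A a b) = if a = i then A j b else 0) (i j : n) (a : ℕ) :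
    D i j (completeHom (fun m => (A ^ m).trace) a)
      = powerConvolution A (completeHom fun m => (A ^ m).trace) a j i := by
  rw [derivation_completeHom _ _ _ (derivation_trace_pow hD i j), powerConvolution,
    Matrix.sum_apply]
  simp [mul_comm]

theorem derivation_completeHom_neg_trace {A : Matrix n n R} {D : n → n → Derivation k R R}
    (hD : ∀ i j a b, D i j (A a b) = if a = i then A j b else 0) (i j : n) (b : ℕ) :
    D i j (completeHom (-fun m => (A ^ m).trace) b)
      = -powerConvolution A (completeHom (-fun m => (A ^ m).trace)) b j i := by
  rw [derivation_completeHom _ _ (fun m => -(A ^ m) j i)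
    (fun m => by simp [derivation_trace_pow hD]), powerConvolution, Matrix.sum_apply]
  simp [mul_comm]

theorem sum_derivation_powerConvolution {A : Matrix n n R} {D : n → n → Derivation k R R}
    (hD : ∀ i j a b, D i j (A a b) = if a = i then A j b else 0) (a : ℕ) :
    ∑ i, ∑ j, D i j (powerConvolution A (completeHom fun m => (A ^ m).trace) a i j)
      = a * (Fintype.card n + a - 1) * completeHom (fun m => (A ^ m).trace) a := by
  set p : ℕ → R := fun m => (A ^ m).trace with hp
  set H := PowerSeries.mk (completeHom p) with hH
  set G : n → n → PowerSeries R := fun i j => positivePart fun m => (A ^ m) i j with hG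
  have hDH : ∀ i j, coeffwise (D i j) H = G j i * H := by
    intro i j
    ext m
    rw [← powerConvolution_apply, ← derivation_completeHom_trace hD]
    simp [coeffwise, hH, hp]
  have hDG : ∑ i, ∑ j, coeffwise (D i j) (G i j)
      = Fintype.card n * positivePart p + positivePart p * positivePart p := by
    ext m
    rw [map_add, coeff_positivePart_mul]
    simp only [map_sum]
    rcases Nat.eq_zero_or_pos m with rfl | hm
    · simp [coeffwise, hG, positivePart]
    · have h1 : ∀ i j, PowerSeries.coeff m (coeffwise (D i j) (G i j))
          = ∑ l ∈ Finset.range m, (A ^ l) i i * (A ^ (m - l)) j j := by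
        intro i j
        simp [coeffwise, hG, positivePart, hm.ne', derivation_matrix_pow hD]
      have h2 : ∑ i, ∑ j, ∑ l ∈ Finset.range m, (A ^ l) i i * (A ^ (m - l)) j j
          = ∑ l ∈ Finset.range m, p l * p (m - l) := by
        simp only [hp, Matrix.trace, Matrix.diag_apply, Finset.sum_mul_sum]
        simp_rw [Finset.sum_comm (t := Finset.range m)]
      simp_rw [h1]
      rw [h2, ← map_natCast (PowerSeries.C (R := R)), PowerSeries.coeff_C_mul]
      obtain ⟨m, rfl⟩ := Nat.exists_eq_succ_of_ne_zero hm.ne'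
      rw [Finset.sum_range_succ', Finset.sum_range_succ']
      simp [positivePart, hp, mul_comm, add_comm]
  have hGG : ∑ i, ∑ j, G i j * G j i
      = PowerSeries.X * PowerSeries.derivative R (positivePart p) - positivePart p := by
    ext m
    simp only [map_sum, map_sub, coeff_X_mul_derivative, hG, coeff_positivePart_mul]
    have h2 : ∀ l ∈ Finset.range m, ∑ i, ∑ j, (A ^ (m - l)) i j * PowerSeries.coeff l
        (positivePart fun q => (A ^ q) j i) = if l = 0 then 0 else p m := by
      intro l hl
      by_cases h : l = 0
      · simp [h, positivePart]
      · simp only [positivePart, PowerSeries.coeff_mk, h, if_false, hp]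
        simp_rw [← Matrix.mul_apply]
        rw [← pow_add, Nat.sub_add_cancel (Finset.mem_range.1 hl).le]
        rfl
    calc _ = ∑ l ∈ Finset.range m, ∑ i, ∑ j, (A ^ (m - l)) i j *
            PowerSeries.coeff l (positivePart fun q => (A ^ q) j i) := by
          simp_rw [Finset.sum_comm (t := Finset.range m)]
      _ = _ := by
        rw [Finset.sum_congr rfl h2]
        cases m with
        | zero => simp [positivePart]
        | succ m =>
          rw [Finset.sum_range_succ']
          simp [positivePart]
          ring
  have hXH : PowerSeries.X * PowerSeries.derivative R H = positivePart p * H :=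
    logDerivative_completeHom p
  have hlap : ∑ i, ∑ j, coeffwise (D i j) (G i j * H)
      = ((Fintype.card n : PowerSeries R) - 1) * (PowerSeries.X * PowerSeries.derivative R H)
        + PowerSeries.X * PowerSeries.derivative R (PowerSeries.X * PowerSeries.derivative R H) := by
    simp_rw [coeffwise_mul, hDH, ← mul_assoc, Finset.sum_add_distrib, ← Finset.sum_mul]
    rw [hDG, hGG, hXH, Derivation.leibniz, smul_eq_mul, smul_eq_mul]
    linear_combination (-positivePart p - ((Fintype.card n : PowerSeries R) - 1)) * hXH
  have := congrArg (PowerSeries.coeff a) hlap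
  rw [map_add, show (Fintype.card n : PowerSeries R) - 1 = PowerSeries.C (Fintype.card n - 1 : R) by
    simp, PowerSeries.coeff_C_mul, coeff_X_mul_derivative, coeff_X_mul_derivative,
    coeff_X_mul_derivative] at this
  simp only [map_sum, coeffwise, PowerSeries.coeff_mk, hH] at this
  simp_rw [powerConvolution_apply]
  rw [this]
  ring

end Laplacian

section LeftDerivation

/-- The derivation of the coordinate ring of `n × n` matrices given by the infinitesimal left
translation along the matrix unit `E i j`. -/
def leftDerivation {n : Type*} [DecidableEq n] (i j : n) :
    Derivation ℂ (MvPolynomial (n × n) ℂ) (MvPolynomial (n × n) ℂ) :=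
  MvPolynomial.mkDerivation ℂ fun ab => if ab.1 = i then MvPolynomial.X (j, ab.2) else 0

theorem leftDerivation_mvPolynomialX {n : Type*} [DecidableEq n] (i j a b : n) :
    leftDerivation i j (Matrix.mvPolynomialX n n ℂ a b)
      = if a = i then Matrix.mvPolynomialX n n ℂ j b else 0 := by
  simp [leftDerivation, MvPolynomial.mkDerivation_X]

/-- Evaluation of a polynomial in the matrix entries. -/
def evalMatrix {n : Type*} (A : Matrix n n ℂ) : MvPolynomial (n × n) ℂ →+* ℂ :=
  MvPolynomial.eval fun ab => A ab.1 ab.2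

theorem continuous_evalMatrix {n : Type*} (p : MvPolynomial (n × n) ℂ) :
    Continuous fun A : Matrix n n ℂ => evalMatrix A p :=
  (MvPolynomial.continuous_eval p).comp (by fun_prop)

variable {n : Type*} [Fintype n] [DecidableEq n]

theorem mvPolynomialX_map_evalMatrix (A : Matrix n n ℂ) :
    (evalMatrix A).mapMatrix (Matrix.mvPolynomialX n n ℂ) = A :=
  Matrix.mvPolynomialX_mapMatrix_eval A

theorem evalMatrix_pow (A : Matrix n n ℂ) (m : ℕ) (i j : n) :
    evalMatrix A ((Matrix.mvPolynomialX n n ℂ ^ m) i j) = (A ^ m) i j := by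
  conv_rhs => rw [← mvPolynomialX_map_evalMatrix A, ← map_pow]
  rfl

theorem evalMatrix_trace_pow (A : Matrix n n ℂ) (m : ℕ) :
    evalMatrix A (Matrix.mvPolynomialX n n ℂ ^ m).trace = (A ^ m).trace := by
  simp [Matrix.trace, evalMatrix_pow]

theorem hasDerivAt_evalMatrix {γ : ℝ → Matrix n n ℂ} {Z : Matrix n n ℂ} {t : ℝ}
    (h : ∀ a b, HasDerivAt (fun t => γ t a b) ((Z * γ t) a b) t) (p : MvPolynomial (n × n) ℂ) :
    HasDerivAt (fun t => evalMatrix (γ t) p)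
      (∑ i, ∑ j, Z i j * evalMatrix (γ t) (leftDerivation i j p)) t := by
  induction p using MvPolynomial.induction_on with
  | C a => simpa [evalMatrix, MvPolynomial.derivation_C] using hasDerivAt_const t a
  | add p q hp hq =>
    simpa [mul_add, Finset.sum_add_distrib] using hp.fun_add hq
  | mul_X p ab hp =>
    have hX : HasDerivAt (fun t => evalMatrix (γ t) (MvPolynomial.X ab)) _ t :=
      (h ab.1 ab.2).congr_deriv rfl |>.congr_of_eventuallyEq (by simp [evalMatrix])
    simp only [map_mul]
    refine (hp.mul hX).congr_deriv ?_
    have h1 : ∑ i, ∑ j, Z i j * evalMatrix (γ t) (leftDerivation i j (MvPolynomial.X ab))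
        = (Z * γ t) ab.1 ab.2 := by
      simp [leftDerivation, MvPolynomial.mkDerivation_X, Matrix.mul_apply, apply_ite, evalMatrix]
    rw [← h1]
    simp only [Derivation.leibniz, smul_eq_mul, map_add, map_mul, mul_add, Finset.sum_add_distrib,
      Finset.mul_sum, Finset.sum_mul]
    rw [add_comm]
    congr 1 <;> exact Finset.sum_congr rfl fun _ _ => Finset.sum_congr rfl fun _ _ => by ring

theorem hasDerivAt_matrix_exp (Z : Matrix n n ℂ) (t : ℝ) (a b : n) :
    HasDerivAt (fun t : ℝ => NormedSpace.exp (t • Z) a b) ((Z * NormedSpace.exp (t • Z)) a b) t := by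
  let _ : NormedRing (Matrix n n ℂ) := Matrix.linftyOpNormedRing
  let _ : NormedAlgebra ℝ (Matrix n n ℂ) := Matrix.linftyOpNormedAlgebra
  have h := hasDerivAt_exp_smul_const' (𝕂 := ℝ) Z t
  exact (hasDerivAt_pi.1 ((hasDerivAt_pi.1 h) a)) b

theorem exp_smul_mem_unitaryGroup {Z : Matrix n n ℂ} (hZ : Zᴴ = -Z) (t : ℝ) :
    NormedSpace.exp (t • Z) ∈ Matrix.unitaryGroup n ℂ := by
  rw [Matrix.mem_unitaryGroup_iff', Matrix.star_eq_conjTranspose, ← Matrix.exp_conjTranspose,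
    Matrix.conjTranspose_smul, hZ, star_trivial, smul_neg,
    ← Matrix.exp_add_of_commute _ _ ((Commute.refl (t • Z)).neg_left), neg_add_cancel,
    NormedSpace.exp_zero]

end LeftDerivation

section HaarUnitary

instance {m n : Type*} [Countable m] [Countable n] : BorelSpace (Matrix m n ℂ) :=
  inferInstanceAs (BorelSpace (m → n → ℂ))

variable {n : Type*} [Fintype n] [DecidableEq n]

theorem isCompact_unitaryGroup : IsCompact {A : Matrix n n ℂ | A ∈ Matrix.unitaryGroup n ℂ} := by
  have hK : IsCompact
      (Set.univ.pi fun _ : n => Set.univ.pi fun _ : n => Metric.closedBall (0 : ℂ) 1) :=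
    isCompact_univ_pi fun _ => isCompact_univ_pi fun _ => isCompact_closedBall _ _
  refine IsCompact.of_isClosed_subset (t := _) hK ?_ ?_
  · simp only [Matrix.mem_unitaryGroup_iff]
    exact isClosed_eq (by fun_prop) continuous_const
  · intro A hA i _ j _
    simpa using entry_norm_bound_of_unitary hA i j

variable {μ : Measure (Matrix n n ℂ)} [IsProbabilityMeasure μ]

theorem ae_mem_unitaryGroup (hsupp : μ {A | A ∈ Matrix.unitaryGroup n ℂ} = 1) :
    ∀ᵐ A ∂μ, A ∈ Matrix.unitaryGroup n ℂ :=
  (mem_ae_iff_prob_eq_one isCompact_unitaryGroup.measurableSet).2 hsupp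

theorem integrable_of_continuous_of_unitary (hsupp : μ {A | A ∈ Matrix.unitaryGroup n ℂ} = 1)
    {E : Type*} [NormedAddCommGroup E] [SecondCountableTopology E] {f : Matrix n n ℂ → E}
    (hf : Continuous f) :
    Integrable f μ := by
  obtain ⟨C, hC⟩ := isCompact_unitaryGroup.exists_bound_of_continuousOn hf.continuousOn
  exact Integrable.of_bound hf.aestronglyMeasurable C
    ((ae_mem_unitaryGroup hsupp).mono fun A hA => hC A hA)

/-- The infinitesimal form of left invariance. -/
theorem integral_skewAdjoint_derivation (hsupp : μ {A | A ∈ Matrix.unitaryGroup n ℂ} = 1)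
    (hinv : ∀ g ∈ Matrix.unitaryGroup n ℂ, μ.map (fun A => g * A) = μ)
    (p q : MvPolynomial (n × n) ℂ) {Z : Matrix n n ℂ} (hZ : Zᴴ = -Z) :
    ∫ A, ((∑ i, ∑ j, Z i j * evalMatrix A (leftDerivation i j p)) * star (evalMatrix A q)
      + evalMatrix A p * star (∑ i, ∑ j, Z i j * evalMatrix A (leftDerivation i j q))) ∂μ = 0 := by
  set F : Matrix n n ℂ → ℂ := fun A => evalMatrix A p * star (evalMatrix A q) with hF
  set G : Matrix n n ℂ → ℂ := fun A =>
    (∑ i, ∑ j, Z i j * evalMatrix A (leftDerivation i j p)) * star (evalMatrix A q)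
      + evalMatrix A p * star (∑ i, ∑ j, Z i j * evalMatrix A (leftDerivation i j q)) with hG
  have hFc : Continuous F := (continuous_evalMatrix p).mul (continuous_evalMatrix q).star
  have hsum : ∀ r, Continuous fun A : Matrix n n ℂ =>
      ∑ i, ∑ j, Z i j * evalMatrix A (leftDerivation i j r) := fun r =>
    continuous_finsetSum _ fun i _ => continuous_finsetSum _ fun j _ =>
      continuous_const.mul (continuous_evalMatrix _)
  have hGc : Continuous G := ((hsum p).mul (continuous_evalMatrix q).star).add
    ((continuous_evalMatrix p).mul (hsum q).star)
  set g : ℝ → Matrix n n ℂ := fun t => NormedSpace.exp (t • Z) with hg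
  have hgU : ∀ t, g t ∈ Matrix.unitaryGroup n ℂ := exp_smul_mem_unitaryGroup hZ
  obtain ⟨C, hC⟩ := isCompact_unitaryGroup.exists_bound_of_continuousOn hGc.continuousOn
  have hder : ∀ A t, HasDerivAt (fun t => F (g t * A)) (G (g t * A)) t := by
    intro A t
    have hγ : ∀ a b, HasDerivAt (fun t => (g t * A) a b) ((Z * (g t * A)) a b) t := by
      intro a b
      rw [← mul_assoc]
      simp only [Matrix.mul_apply (N := A)]
      exact HasDerivAt.fun_sum fun c _ => (hasDerivAt_matrix_exp Z t a c).mul_const _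
    have h1 := hasDerivAt_evalMatrix (γ := fun t => g t * A) hγ p
    have h2 := hasDerivAt_evalMatrix (γ := fun t => g t * A) hγ q
    exact h1.mul h2.star
  have key := (hasDerivAt_integral_of_dominated_loc_of_deriv_le (μ := μ)
    (F := fun t A => F (g t * A)) (F' := fun t A => G (g t * A)) (x₀ := (0 : ℝ))
    (bound := fun _ => C) Filter.univ_mem
    (Filter.Eventually.of_forall fun t =>
      (hFc.comp (continuous_const.mul continuous_id)).aestronglyMeasurable)
    (integrable_of_continuous_of_unitary hsupp (hFc.comp (continuous_const.mul continuous_id)))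
    (hGc.comp (continuous_const.mul continuous_id)).aestronglyMeasurable
    ((ae_mem_unitaryGroup hsupp).mono fun A hA t _ => hC _ (mul_mem (hgU t) hA))
    (integrable_const C) (Filter.Eventually.of_forall fun A t _ => hder A t)).2
  have hconst : (fun t => ∫ A, F (g t * A) ∂μ) = fun _ => ∫ A, F A ∂μ := by
    funext t
    conv_rhs => rw [← hinv (g t) (hgU t)]
    exact (integral_map (continuous_const.mul continuous_id).measurable.aemeasurable
      hFc.aestronglyMeasurable).symm
  rw [hconst] at key
  have := key.unique (hasDerivAt_const _ _)
  simpa [hg, NormedSpace.exp_zero] using this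

theorem integral_leftDerivation (hsupp : μ {A | A ∈ Matrix.unitaryGroup n ℂ} = 1)
    (hinv : ∀ g ∈ Matrix.unitaryGroup n ℂ, μ.map (fun A => g * A) = μ)
    (p q : MvPolynomial (n × n) ℂ) (i j : n) :
    ∫ A, evalMatrix A (leftDerivation i j p) * star (evalMatrix A q) ∂μ
      = ∫ A, evalMatrix A p * star (evalMatrix A (leftDerivation j i q)) ∂μ := by
  have hint : ∀ r s : MvPolynomial (n × n) ℂ,
      Integrable (fun A => evalMatrix A r * star (evalMatrix A s)) μ := fun r s =>
    integrable_of_continuous_of_unitary hsupp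
      ((continuous_evalMatrix r).mul (continuous_evalMatrix s).star)
  set a : n → n → ℂ := fun i j =>
    ∫ A, evalMatrix A (leftDerivation i j p) * star (evalMatrix A q) ∂μ with ha
  set b : n → n → ℂ := fun i j =>
    ∫ A, evalMatrix A p * star (evalMatrix A (leftDerivation i j q)) ∂μ with hb
  have hlin : ∀ Z : Matrix n n ℂ, Zᴴ = -Z →
      ∑ i, ∑ j, (Z i j * a i j + star (Z i j) * b i j) = 0 := by
    intro Z hZ
    rw [← integral_skewAdjoint_derivation hsupp hinv p q hZ]
    have hterm : ∀ i j, Integrable (fun A =>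
        Z i j * (evalMatrix A (leftDerivation i j p) * star (evalMatrix A q))
          + star (Z i j) * (evalMatrix A p * star (evalMatrix A (leftDerivation i j q)))) μ :=
      fun i j => ((hint _ _).const_mul _).add ((hint _ _).const_mul _)
    calc _ = ∑ i, ∑ j, ∫ A,
          (Z i j * (evalMatrix A (leftDerivation i j p) * star (evalMatrix A q))
          + star (Z i j) * (evalMatrix A p * star (evalMatrix A (leftDerivation i j q)))) ∂μ := by
          refine Finset.sum_congr rfl fun i _ => Finset.sum_congr rfl fun j _ => ?_
          rw [integral_add ((hint _ _).const_mul _) ((hint _ _).const_mul _),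
            integral_const_mul, integral_const_mul]
      _ = ∫ A, ∑ i, ∑ j,
          (Z i j * (evalMatrix A (leftDerivation i j p) * star (evalMatrix A q))
          + star (Z i j) * (evalMatrix A p * star (evalMatrix A (leftDerivation i j q)))) ∂μ := by
          rw [integral_finsetSum _ fun i _ => integrable_finsetSum _ fun j _ => hterm i j]
          refine Finset.sum_congr rfl fun i _ => ?_
          rw [integral_finsetSum _ fun j _ => hterm i j]
      _ = _ := by
          refine integral_congr_ae (Filter.Eventually.of_forall fun A => ?_)
          simp only [star_sum, star_mul', Finset.sum_mul, Finset.mul_sum,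
            ← Finset.sum_add_distrib]
          exact Finset.sum_congr rfl fun i _ => Finset.sum_congr rfl fun j _ => by ring
  have hsingle : ∀ (i j : n) (c : ℂ) (f : n → n → ℂ),
      ∑ k, ∑ l, Matrix.single i j c k l * f k l = c * f i j := by
    intro i j c f
    rw [Finset.sum_eq_single i, Finset.sum_eq_single j] <;>
      simp +contextual [Matrix.single_apply, eq_comm]
  have h1 := hlin (Matrix.single i j 1 - Matrix.single j i 1) (by simp)
  have h2 := hlin (Matrix.single i j Complex.I + Matrix.single j i Complex.I) (by
    simp [Matrix.conjTranspose_single, add_comm, ← Matrix.single_neg])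
  have hs : ∀ (i j k l : n) (c : ℂ),
      star (Matrix.single i j c k l) = Matrix.single i j (star c) k l := by
    intro i j k l c
    simp only [Matrix.single_apply, apply_ite star, star_zero]
  simp only [Matrix.sub_apply, Matrix.add_apply, star_sub, star_add, hs, sub_mul, add_mul,
    Finset.sum_add_distrib, Finset.sum_sub_distrib, hsingle] at h1 h2
  simp only [star_one, Complex.star_def, Complex.conj_I] at h1 h2
  change a i j = b j i
  linear_combination (1 / 2 : ℂ) * h1 - (Complex.I / 2) * h2
    + ((a i j + a j i - b i j - b j i) / 2) * Complex.I_sq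

end HaarUnitary

section HookRecursion

/-- The integration by parts recursion determines the hook moments `c (k - b) b` for `b < N`. -/
theorem hook_moment_of_recursion {c : ℕ → ℕ → ℂ} {N : ℕ} (hN : 1 ≤ N) (h0 : c 0 0 = N)
    (hrec : ∀ a b : ℕ, (a + b : ℂ) * ∑ m ∈ Finset.range a, c m b
      = a * (N + a - 1) * c a b
        - ((a + b : ℂ) * ∑ j ∈ Finset.range b, c (a + b - j) j + b * c a b))
    (hsum : ∀ k ≠ 0, ∑ j ∈ Finset.range (k + 1), c (k - j) j = 0) {k : ℕ} (hk : k ≠ 0) :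
    c k 0 = 1 ∧ ∀ b, b ≠ 0 → b < N → b < k → c (k - b) b = 0 := by
  induction k using Nat.strong_induction_on with
  | _ k ih =>
    have hk0 : c k 0 = 1 := by
      have h := hrec k 0
      obtain ⟨k, rfl⟩ := Nat.exists_eq_succ_of_ne_zero hk
      have h1 : ∑ m ∈ Finset.range (k + 1), c m 0 = N + k := by
        rw [Finset.sum_range_succ', h0,
          Finset.sum_congr rfl fun m hm => (ih (m + 1) (by simpa using hm) (by simp)).1]
        simp [add_comm]
      rw [h1] at h
      have h2 : ((k + 1 : ℕ) : ℂ) * (N + k) ≠ 0 := by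
        have : N + k ≠ 0 := by omega
        exact mul_ne_zero (by exact_mod_cast k.succ_ne_zero) (by exact_mod_cast this)
      refine mul_left_cancel₀ h2 ?_
      push_cast at h ⊢
      simp only [Finset.range_zero, Finset.sum_empty] at h
      linear_combination -h
    refine ⟨hk0, fun b => ?_⟩
    induction b using Nat.strong_induction_on with
    | _ b ihb =>
      intro hb hbN hbk
      obtain ⟨a, rfl⟩ := Nat.exists_eq_add_of_lt hbk
      rw [show b + a + 1 - b = a + 1 by omega]
      have hc0 : c 0 b = -1 := by
        have h := hsum b hb
        obtain ⟨b, rfl⟩ := Nat.exists_eq_succ_of_ne_zero hb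
        rw [Finset.sum_range_succ, Finset.sum_range_succ', Finset.sum_eq_zero] at h
        · simp only [Nat.sub_zero, Nat.sub_self, (ih _ hbk hb).1] at h
          linear_combination h
        · intro j hj
          have := Finset.mem_range.1 hj
          exact (ih _ hbk hb).2 _ (by omega) (by omega) (by omega)
      have hl : ∑ m ∈ Finset.range (a + 1), c m b = -1 := by
        rw [Finset.sum_range_succ', hc0, Finset.sum_eq_zero, zero_add]
        intro m hm
        have := Finset.mem_range.1 hm
        simpa using (ih (m + 1 + b) (by omega) (by omega)).2 b hb hbN (by omega)
      have hr : ∑ j ∈ Finset.range b, c (a + 1 + b - j) j = 1 := by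
        obtain ⟨b, rfl⟩ := Nat.exists_eq_succ_of_ne_zero hb
        rw [show a + 1 + (b + 1) = b + 1 + a + 1 by ring, Finset.sum_range_succ',
          Finset.sum_eq_zero, zero_add]
        · exact hk0
        · intro j hj
          have := Finset.mem_range.1 hj
          exact ihb _ (by omega) (by omega) (by omega) (by omega)
      have h := hrec (a + 1) b
      rw [hl, hr] at h
      have hne : (((a + 1) * (N + a) - b : ℕ) : ℂ) ≠ 0 := by
        have : b < (a + 1) * (N + a) := by nlinarith
        exact_mod_cast (Nat.sub_pos_of_lt this).ne'
      rw [Nat.cast_sub (by nlinarith)] at hne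
      refine (mul_eq_zero.1 ?_).resolve_left hne
      push_cast at h ⊢
      linear_combination -h

theorem sum_natCast_mul_hook_moment {c : ℕ → ℕ → ℂ} {N : ℕ} (hN : 1 ≤ N) (h0 : c 0 0 = N)
    (hrec : ∀ a b : ℕ, (a + b : ℂ) * ∑ m ∈ Finset.range a, c m b
      = a * (N + a - 1) * c a b
        - ((a + b : ℂ) * ∑ j ∈ Finset.range b, c (a + b - j) j + b * c a b))
    (hsum : ∀ k ≠ 0, ∑ j ∈ Finset.range (k + 1), c (k - j) j = 0)
    (hvan : ∀ a b, N < b → c a b = 0) {k : ℕ} (hk : k ≠ 0) :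
    ∑ j ∈ Finset.range (k + 1), (j : ℂ) * c (k - j) j = -(min k N : ℕ) := by
  obtain ⟨hk0, hkb⟩ := hook_moment_of_recursion hN h0 hrec hsum hk
  have hM : min k N ≠ 0 := by omega
  have hsupport : ∀ f : ℕ → ℂ, ∑ j ∈ Finset.range (k + 1), f j * c (k - j) j
      = f 0 + f (min k N) * c (k - min k N) (min k N) := by
    intro f
    rw [← Finset.sum_subset (s₁ := {0, min k N}), Finset.sum_pair hM.symm]
    · simp [hk0]
    · intro j
      simp only [Finset.mem_insert, Finset.mem_singleton, Finset.mem_range]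
      omega
    · intro j hj hj'
      simp only [Finset.mem_insert, Finset.mem_singleton, Finset.mem_range, not_or] at hj hj'
      rcases lt_or_ge N j with h | h
      · rw [hvan _ _ h, mul_zero]
      · rw [hkb j hj'.1 (by omega) (by omega), mul_zero]
  have h1 := hsupport 1
  simp only [Pi.one_apply, one_mul, hsum k hk] at h1
  rw [hsupport, Nat.cast_zero]
  linear_combination (-(min k N : ℕ) : ℂ) * h1

end HookRecursion

section HookMoment

variable {n : Type*} [Fintype n] [DecidableEq n]

variable (n) in
/-- The complete homogeneous symmetric polynomial in the eigenvalues of the generic matrix. -/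
def genericComplete (a : ℕ) : MvPolynomial (n × n) ℂ :=
  completeHom (fun m => (Matrix.mvPolynomialX n n ℂ ^ m).trace) a

variable (n) in
/-- The elementary symmetric polynomial in the eigenvalues of the generic matrix, with sign
`(-1) ^ b`. -/
def genericElementary (b : ℕ) : MvPolynomial (n × n) ℂ :=
  completeHom (-fun m => (Matrix.mvPolynomialX n n ℂ ^ m).trace) b

theorem sum_leftDerivation_mul_genericElementary (a b : ℕ) :
    ∑ i, ∑ j, leftDerivation i j (powerConvolution (Matrix.mvPolynomialX n n ℂ)
        (genericComplete n) a i j * genericElementary n b)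
      = a * (Fintype.card n + a - 1) * (genericComplete n a * genericElementary n b)
        - ((a + b : ℕ) * (∑ j ∈ Finset.range b,
            genericComplete n (a + b - j) * genericElementary n j)
          + b * (genericComplete n a * genericElementary n b)) := by
  have hD := leftDerivation_mvPolynomialX (n := n)
  have h1 := sum_derivation_powerConvolution hD a
  have h2 := trace_powerConvolution_mul_powerConvolution (Matrix.mvPolynomialX n n ℂ) a b
  have h3 := fun i j => derivation_completeHom_neg_trace hD i j b
  change ∑ i, ∑ j, leftDerivation i j (powerConvolution _ (genericComplete n) a i j)
    = _ * genericComplete n a at h1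
  change (powerConvolution (Matrix.mvPolynomialX n n ℂ) (genericComplete n) a
    * powerConvolution (Matrix.mvPolynomialX n n ℂ) (genericElementary n) b).trace
    = _ * (∑ j ∈ Finset.range b, genericComplete n (a + b - j) * genericElementary n j)
      + b * (genericComplete n a * genericElementary n b) at h2
  change ∀ i j, leftDerivation i j (genericElementary n b)
    = -powerConvolution _ (genericElementary n) b j i at h3
  rw [← h2, ← mul_assoc, ← h1]
  simp only [Derivation.leibniz, smul_eq_mul, h3, Finset.sum_add_distrib, Matrix.trace,
    Matrix.diag_apply, Matrix.mul_apply, Finset.sum_mul, mul_neg, Finset.sum_neg_distrib]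
  rw [add_comm, ← sub_eq_add_neg]
  simp only [mul_comm]

/-- The correlation of a power sum with a product of a complete and an elementary symmetric
polynomial of the same total degree. -/
def hookMoment (μ : Measure (Matrix n n ℂ)) (a b : ℕ) : ℂ :=
  ∫ A, (A ^ (a + b)).trace * star (evalMatrix A (genericComplete n a * genericElementary n b)) ∂μ

theorem hookMoment_zero_zero (μ : Measure (Matrix n n ℂ)) [IsProbabilityMeasure μ] :
    hookMoment μ 0 0 = Fintype.card n := by
  simp [hookMoment, genericComplete, genericElementary, completeHom]

theorem hookMoment_eq_zero (μ : Measure (Matrix n n ℂ)) (a : ℕ) {b : ℕ}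
    (hb : Fintype.card n < b) : hookMoment μ a b = 0 := by
  simp [hookMoment, genericElementary, completeHom_neg_trace_eq_zero _ hb]

theorem sum_apply_mul_star_apply_pow {A : Matrix n n ℂ} (hA : A ∈ Matrix.unitaryGroup n ℂ)
    (l m : ℕ) : ∑ i, ∑ j, (A ^ (l + m)) i j * star ((A ^ m) i j) = (A ^ l).trace := by
  have h : A ^ (l + m) * star (A ^ m) = A ^ l := by
    rw [pow_add, mul_assoc, Matrix.mem_unitaryGroup_iff.1 (pow_mem hA m), mul_one]
  rw [← h, Matrix.trace]
  simp only [Matrix.diag_apply, Matrix.mul_apply, Matrix.star_apply]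

variable {μ : Measure (Matrix n n ℂ)} [IsProbabilityMeasure μ]

theorem integrable_trace_pow_mul_star (hsupp : μ {A | A ∈ Matrix.unitaryGroup n ℂ} = 1) (k : ℕ)
    (q : MvPolynomial (n × n) ℂ) :
    Integrable (fun A => (A ^ k).trace * star (evalMatrix A q)) μ :=
  integrable_of_continuous_of_unitary hsupp
    ((by fun_prop : Continuous fun A : Matrix n n ℂ => (A ^ k).trace).mul
      (continuous_evalMatrix q).star)

theorem hookMoment_sub (μ : Measure (Matrix n n ℂ)) {k j : ℕ} (hj : j ≤ k) :
    hookMoment μ (k - j) j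
      = ∫ A, (A ^ k).trace
          * star (evalMatrix A (genericComplete n (k - j) * genericElementary n j)) ∂μ := by
  rw [hookMoment, Nat.sub_add_cancel hj]

theorem sum_mul_hookMoment (hsupp : μ {A | A ∈ Matrix.unitaryGroup n ℂ} = 1) (w : ℕ → ℕ)
    {s : Finset ℕ} {k : ℕ} (hs : ∀ j ∈ s, j ≤ k) :
    ∑ j ∈ s, (w j : ℂ) * hookMoment μ (k - j) j
      = ∫ A, (A ^ k).trace * star (evalMatrix A
          (∑ j ∈ s, (w j : MvPolynomial (n × n) ℂ)
            * (genericComplete n (k - j) * genericElementary n j))) ∂μ := by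
  simp only [map_sum, star_sum, Finset.mul_sum]
  rw [integral_finsetSum _ fun j _ => integrable_trace_pow_mul_star hsupp _ _]
  refine Finset.sum_congr rfl fun j hj => ?_
  rw [hookMoment_sub μ (hs j hj), ← integral_const_mul]
  refine integral_congr_ae (Filter.Eventually.of_forall fun A => ?_)
  simp
  ring

theorem sum_hookMoment_eq_zero (hsupp : μ {A | A ∈ Matrix.unitaryGroup n ℂ} = 1) {k : ℕ}
    (hk : k ≠ 0) : ∑ j ∈ Finset.range (k + 1), hookMoment μ (k - j) j = 0 := by
  have h := sum_mul_hookMoment hsupp (fun _ => 1) (s := Finset.range (k + 1)) (k := k)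
    fun j hj => Nat.lt_succ_iff.1 (Finset.mem_range.1 hj)
  simp only [Nat.cast_one, one_mul] at h
  rw [h]
  simp [genericComplete, genericElementary, sum_completeHom_neg_mul _ hk]

theorem sum_natCast_mul_hookMoment (hsupp : μ {A | A ∈ Matrix.unitaryGroup n ℂ} = 1) {k : ℕ}
    (hk : k ≠ 0) : ∑ j ∈ Finset.range (k + 1), (j : ℂ) * hookMoment μ (k - j) j
      = -∫ A, (A ^ k).trace * star (A ^ k).trace ∂μ := by
  have h := sum_mul_hookMoment hsupp id (s := Finset.range (k + 1)) (k := k)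
    fun j hj => Nat.lt_succ_iff.1 (Finset.mem_range.1 hj)
  simp only [id] at h
  rw [h]
  simp only [genericComplete, genericElementary, sum_natCast_mul_completeHom_neg _ hk]
  simp only [map_neg, star_neg, mul_neg, integral_neg, evalMatrix_trace_pow]

theorem hookMoment_recursion (hsupp : μ {A | A ∈ Matrix.unitaryGroup n ℂ} = 1)
    (hinv : ∀ g ∈ Matrix.unitaryGroup n ℂ, μ.map (fun A => g * A) = μ) (a b : ℕ) :
    (a + b : ℂ) * ∑ m ∈ Finset.range a, hookMoment μ m b
      = a * (Fintype.card n + a - 1) * hookMoment μ a b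
        - ((a + b : ℂ) * ∑ j ∈ Finset.range b, hookMoment μ (a + b - j) j
          + b * hookMoment μ a b) := by
  set X := Matrix.mvPolynomialX n n ℂ with hX
  set U := powerConvolution X (genericComplete n) a with hU
  set e := genericElementary n b with he
  have hparts : ∫ A, ∑ i, ∑ j, evalMatrix A (leftDerivation j i (X ^ (a + b)).trace)
        * star (evalMatrix A (U i j * e)) ∂μ
      = ∫ A, (A ^ (a + b)).trace
        * star (evalMatrix A (∑ i, ∑ j, leftDerivation i j (U i j * e))) ∂μ := by
    have hint : ∀ r s : MvPolynomial (n × n) ℂ,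
        Integrable (fun A => evalMatrix A r * star (evalMatrix A s)) μ := fun r s =>
      integrable_of_continuous_of_unitary hsupp
        ((continuous_evalMatrix r).mul (continuous_evalMatrix s).star)
    simp only [← evalMatrix_trace_pow, map_sum, star_sum, Finset.mul_sum]
    rw [integral_finsetSum _ fun i _ => integrable_finsetSum _ fun j _ => hint _ _,
      integral_finsetSum _ fun i _ => integrable_finsetSum _ fun j _ => hint _ _]
    refine Finset.sum_congr rfl fun i _ => ?_
    rw [integral_finsetSum _ fun j _ => hint _ _, integral_finsetSum _ fun j _ => hint _ _]
    exact Finset.sum_congr rfl fun j _ => integral_leftDerivation hsupp hinv _ _ j i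
  have hleft : ∫ A, ∑ i, ∑ j, evalMatrix A (leftDerivation j i (X ^ (a + b)).trace)
        * star (evalMatrix A (U i j * e)) ∂μ
      = (a + b : ℂ) * ∑ m ∈ Finset.range a, hookMoment μ m b := by
    simp only [hookMoment]
    rw [← integral_finsetSum _ fun m _ => integrable_trace_pow_mul_star hsupp _ _,
      ← integral_const_mul]
    refine integral_congr_ae ((ae_mem_unitaryGroup hsupp).mono fun A hA => ?_)
    dsimp only
    have hterm : ∀ i j, evalMatrix A (leftDerivation j i (X ^ (a + b)).trace)
          * star (evalMatrix A (U i j * e))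
        = ∑ m ∈ Finset.range a, (a + b : ℂ) * star (evalMatrix A (genericComplete n m * e))
          * ((A ^ (a + b)) i j * star ((A ^ (a - m)) i j)) := by
      intro i j
      rw [derivation_trace_pow leftDerivation_mvPolynomialX, hU, powerConvolution,
        Matrix.sum_apply]
      simp only [Matrix.smul_apply, smul_eq_mul, map_mul, map_sum, star_mul', star_sum,
        Finset.sum_mul, Finset.mul_sum, hX, evalMatrix_pow, map_natCast]
      push_cast
      exact Finset.sum_congr rfl fun m _ => by ring
    simp only [hterm, Finset.sum_comm (t := Finset.range a), ← Finset.mul_sum]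
    rw [Finset.mul_sum]
    refine Finset.sum_congr rfl fun m hm => ?_
    have := Finset.mem_range.1 hm
    rw [show a + b = m + b + (a - m) by omega, sum_apply_mul_star_apply_pow hA]
    ring
  have hright : ∫ A, (A ^ (a + b)).trace
        * star (evalMatrix A (∑ i, ∑ j, leftDerivation i j (U i j * e))) ∂μ
      = a * (Fintype.card n + a - 1) * hookMoment μ a b
        - ((a + b : ℂ) * ∑ j ∈ Finset.range b, hookMoment μ (a + b - j) j
          + b * hookMoment μ a b) := by
    have h1 := sum_mul_hookMoment hsupp (fun _ => 1) (s := Finset.range b) (k := a + b)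
      fun j hj => by have := Finset.mem_range.1 hj; omega
    simp only [Nat.cast_one, one_mul] at h1
    have hi := integrable_trace_pow_mul_star hsupp (a + b)
    rw [h1, sum_leftDerivation_mul_genericElementary, hookMoment, ← integral_const_mul,
      ← integral_const_mul, ← integral_const_mul,
      ← integral_add ((hi _).const_mul _) ((hi _).const_mul _),
      ← integral_sub ((hi _).const_mul _) (((hi _).const_mul _).fun_add ((hi _).const_mul _))]
    refine integral_congr_ae (Filter.Eventually.of_forall fun A => ?_)
    simp
    ring
  rw [← hleft, hparts, hright]

/-- The second moment of the trace of a power of a Haar distributed unitary matrix. -/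
theorem integral_trace_pow_mul_star [Nonempty n]
    (hsupp : μ {A | A ∈ Matrix.unitaryGroup n ℂ} = 1)
    (hinv : ∀ g ∈ Matrix.unitaryGroup n ℂ, μ.map (fun A => g * A) = μ) {k : ℕ} (hk : k ≠ 0) :
    ∫ A, (A ^ k).trace * star (A ^ k).trace ∂μ = (min k (Fintype.card n) : ℕ) := by
  have h := sum_natCast_mul_hook_moment Fintype.card_pos (hookMoment_zero_zero μ)
    (hookMoment_recursion hsupp hinv) (fun _ => sum_hookMoment_eq_zero hsupp)
    (fun a _ => hookMoment_eq_zero μ a) hk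
  rw [sum_natCast_mul_hookMoment hsupp hk] at h
  exact neg_injective h

theorem integral_norm_trace_pow_sq [Nonempty n]
    (hsupp : μ {A | A ∈ Matrix.unitaryGroup n ℂ} = 1)
    (hinv : ∀ g ∈ Matrix.unitaryGroup n ℂ, μ.map (fun A => g * A) = μ) {k : ℕ} (hk : k ≠ 0) :
    ∫ A, ‖(A ^ k).trace‖ ^ 2 ∂μ = (min k (Fintype.card n) : ℕ) := by
  have h := integral_trace_pow_mul_star hsupp hinv hk
  have h1 : ∀ z : ℂ, z * star z = ((‖z‖ ^ 2 : ℝ) : ℂ) := fun z => by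
    rw [Complex.star_def, Complex.mul_conj']; push_cast; rfl
  simp only [h1] at h
  rw [integral_complex_ofReal] at h
  apply Complex.ofReal_injective
  rw [h, Complex.ofReal_natCast]

end HookMoment

/-- For `A` Haar-distributed on `U(N)`,
`E[ Σ_{k≥1} |Tr(A^k)|²/k² ] = Σ_{k≥1} min{k, N}/k²`. -/
theorem expected_traceSum_unitary
    (N : ℕ) (hN : 1 ≤ N)
    (μ : Measure (Matrix (Fin N) (Fin N) ℂ)) [IsProbabilityMeasure μ]
    (hsupp : μ {A | A ∈ Matrix.unitaryGroup (Fin N) ℂ} = 1)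
    (hinv : ∀ g ∈ Matrix.unitaryGroup (Fin N) ℂ, μ.map (fun A => g * A) = μ) :
    ∫ A, (∑' k : ℕ, ‖(A ^ (k + 1)).trace‖ ^ 2 / ((k : ℝ) + 1) ^ 2) ∂μ
      = ∑' k : ℕ, min ((k : ℝ) + 1) (N : ℝ) / ((k : ℝ) + 1) ^ 2 := by
  have : Nonempty (Fin N) := ⟨⟨0, hN⟩⟩
  have hint : ∀ k : ℕ, ∫ A, ‖(A ^ (k + 1)).trace‖ ^ 2 / ((k : ℝ) + 1) ^ 2 ∂μ
      = min ((k : ℝ) + 1) (N : ℝ) / ((k : ℝ) + 1) ^ 2 := by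
    intro k
    rw [integral_div, integral_norm_trace_pow_sq hsupp hinv k.succ_ne_zero]
    simp
  have hnorm : ∀ (k : ℕ) (A : Matrix (Fin N) (Fin N) ℂ),
      ‖‖(A ^ (k + 1)).trace‖ ^ 2 / ((k : ℝ) + 1) ^ 2‖
        = ‖(A ^ (k + 1)).trace‖ ^ 2 / ((k : ℝ) + 1) ^ 2 := fun k A =>
    Real.norm_of_nonneg (by positivity)
  rw [← integral_tsum_of_summable_integral_norm]
  · exact tsum_congr hint
  · exact fun k => integrable_of_continuous_of_unitary hsupp
      (((by fun_prop : Continuous fun A : Matrix (Fin N) (Fin N) ℂ => (A ^ (k + 1)).trace).norm.pow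
        2).div_const _)
  · simp only [hnorm, hint]
    refine Summable.of_nonneg_of_le (fun k => by positivity) (fun k => ?_)
      (((summable_nat_add_iff 1).2 (Real.summable_one_div_nat_pow.2 one_lt_two)).mul_left (N : ℝ))
    rw [mul_one_div]
    push_cast
    gcongr
    exact min_le_right _ _
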